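/- For every integer p ≥ 1 and every real x ≥ 0, one has 1 − erf_p(x) ≤ 2^{p/2} · e^{−x²/2}. -/

import Mathlib

open MeasureTheory

/-- The constant `c(p) = p / Γ(p/2 + 1)`. -/
noncomputable def cP (p : ℕ) : ℝ := p / Real.Gamma ((p : ℝ) / 2 + 1)

/-- The generalized error function `erf_p(x) = c(p) ∫_0^x r^{p-1} e^{-r²} dr`. -/
noncomputable def erfP (p : ℕ) (x : ℝ) : ℝ :=
  cP p * ∫ r in (0 : ℝ)..x, r ^ (p - 1) * Real.exp (-r ^ 2)

theorem integrableOn_pow_mul_exp_neg_mul_sq (n : ℕ) {b : ℝ} (hb : 0 < b) :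
    IntegrableOn (fun r : ℝ => r ^ n * Real.exp (-b * r ^ 2)) (Set.Ioi 0) := by
  have hn : (-1 : ℝ) < n := by linarith [(Nat.cast_nonneg n : (0 : ℝ) ≤ n)]
  simpa only [Real.rpow_natCast] using integrableOn_rpow_mul_exp_neg_mul_sq hb hn

/-- The radial Gaussian integral of parameter `b`, normalized by `c(p)`. -/
theorem cP_mul_integral_exp_neg_mul_sq {p : ℕ} (hp : 1 ≤ p) {b : ℝ} (hb : 0 < b) :
    cP p * ∫ r in Set.Ioi (0 : ℝ), r ^ (p - 1) * Real.exp (-b * r ^ 2) =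
      b ^ (-((p : ℝ) / 2)) := by
  have hp0 : (0 : ℝ) < p := by exact_mod_cast hp
  have hq : (-1 : ℝ) < (p - 1 : ℕ) := by linarith [(Nat.cast_nonneg (p - 1) : (0 : ℝ) ≤ _)]
  have hI := integral_rpow_mul_exp_neg_mul_rpow (p := 2) two_pos hq hb
  simp only [Real.rpow_natCast, Real.rpow_ofNat] at hI
  have hcast : ((p - 1 : ℕ) : ℝ) + 1 = p := by
    rw [Nat.cast_sub hp]
    simp
  rw [hI, cP, neg_div, hcast, Real.Gamma_add_one (by positivity)]
  have hG : Real.Gamma ((p : ℝ) / 2) ≠ 0 := (Real.Gamma_pos_of_pos (by positivity)).ne'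
  field_simp

theorem one_sub_erfP_eq_integral_Ioi {p : ℕ} (hp : 1 ≤ p) {x : ℝ} (hx : 0 ≤ x) :
    1 - erfP p x = cP p * ∫ r in Set.Ioi x, r ^ (p - 1) * Real.exp (-r ^ 2) := by
  have hint := integrableOn_pow_mul_exp_neg_mul_sq (p - 1) one_pos
  have hone := cP_mul_integral_exp_neg_mul_sq hp one_pos
  simp only [neg_mul, one_mul, Real.one_rpow] at hint hone
  rw [← hone, erfP, ← mul_sub, ← intervalIntegral.integral_interval_add_Ioi hint
    (hint.mono_set (Set.Ioi_subset_Ioi hx)), add_sub_cancel_left]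

theorem integral_Ioi_pow_mul_exp_neg_sq_le (n : ℕ) {x : ℝ} (hx : 0 ≤ x) :
    ∫ r in Set.Ioi x, r ^ n * Real.exp (-r ^ 2) ≤
      Real.exp (-x ^ 2 / 2) * ∫ r in Set.Ioi (0 : ℝ), r ^ n * Real.exp (-(1 / 2) * r ^ 2) := by
  have hone := integrableOn_pow_mul_exp_neg_mul_sq n one_pos
  simp only [neg_mul, one_mul] at hone
  have hhalf := integrableOn_pow_mul_exp_neg_mul_sq n (one_half_pos (α := ℝ))
  have hsub : Set.Ioi x ⊆ Set.Ioi 0 := Set.Ioi_subset_Ioi hx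
  rw [← integral_const_mul]
  calc
    _ ≤ ∫ r in Set.Ioi x, Real.exp (-x ^ 2 / 2) * (r ^ n * Real.exp (-(1 / 2) * r ^ 2)) := by
      refine setIntegral_mono_on (hone.mono_set hsub) ((hhalf.mono_set hsub).const_mul _)
        measurableSet_Ioi fun r hr => ?_
      have hr' : x < r := hr
      rw [mul_left_comm, ← Real.exp_add]
      refine mul_le_mul_of_nonneg_left (Real.exp_le_exp.mpr ?_) (pow_nonneg (hx.trans hr'.le) n)
      nlinarith
    _ ≤ _ := by
      refine setIntegral_mono_set (hhalf.const_mul _) ?_ hsub.eventuallyLE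
      filter_upwards [self_mem_ae_restrict measurableSet_Ioi] with r hr
      have hr' : (0 : ℝ) < r := hr
      simp only [Pi.zero_apply]
      positivity

theorem one_sub_erfP_le (p : ℕ) (hp : 1 ≤ p) (x : ℝ) (hx : 0 ≤ x) :
    1 - erfP p x ≤ (2 : ℝ) ^ ((p : ℝ) / 2) * Real.exp (-x ^ 2 / 2) := by
  have hc : 0 ≤ cP p := div_nonneg p.cast_nonneg (Real.Gamma_pos_of_pos (by positivity)).le
  calc
    1 - erfP p x = cP p * ∫ r in Set.Ioi x, r ^ (p - 1) * Real.exp (-r ^ 2) :=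
      one_sub_erfP_eq_integral_Ioi hp hx
    _ ≤ cP p * (Real.exp (-x ^ 2 / 2) *
        ∫ r in Set.Ioi (0 : ℝ), r ^ (p - 1) * Real.exp (-(1 / 2) * r ^ 2)) :=
      mul_le_mul_of_nonneg_left (integral_Ioi_pow_mul_exp_neg_sq_le _ hx) hc
    _ = _ := by
      rw [mul_left_comm, cP_mul_integral_exp_neg_mul_sq hp one_half_pos, mul_comm, one_div,
        Real.inv_rpow zero_le_two, Real.rpow_neg zero_le_two, inv_inv]
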